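/- arXiv:2104.01001 — 2 statements merged into one kernel-verified Lean document; each statement's English description precedes it below -/
import Mathlib

section
/- Let n, d be positive integers and N = n·d. Let Λ ∈ ℂ^{N×N} be a diagonal matrix, let P ∈ ℂ^{N×N} be a permutation matrix, and let Φ ∈ ℂ^{n×n} be a diagonal matrix. Define Λ̲ := (I_n ⊗ 1_dᵀ)·P·Λ ∈ ℂ^{n×N}. Then Λ̲ᴴ Φ Λ̲ = Pᵀ (Φ ⊗ I_d) P · Λ̲ᴴ Λ̲, where ᴴ denotes conjugate transpose. -/
open Matrix Kronecker

/-- A permutation matrix: the 0–1 matrix associated with a permutation `σ`. -/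
def IsPermMatrix {N : Type*} [Fintype N] [DecidableEq N] (P : Matrix N N ℂ) : Prop :=
  ∃ σ : Equiv.Perm N, ∀ i j, P i j = if σ i = j then 1 else 0

/-- The matrix `I_n ⊗ 1_dᵀ ∈ ℂ^{n×(n·d)}`, where `1_dᵀ` is the all-ones row vector,
with the natural identification of `Fin n × Fin 1` with `Fin n`. -/
noncomputable def idKronOnesRow (n d : ℕ) : Matrix (Fin n) (Fin n × Fin d) ℂ :=
  Matrix.reindex (Equiv.prodUnique (Fin n) (Fin 1)) (Equiv.refl (Fin n × Fin d))
    ((1 : Matrix (Fin n) (Fin n) ℂ) ⊗ₖ Matrix.of (fun (_ : Fin 1) (_ : Fin d) => (1 : ℂ)))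

theorem IsPermMatrix.exists_eq_submatrix {N : Type*} [Fintype N] [DecidableEq N]
    {P : Matrix N N ℂ} (hP : IsPermMatrix P) :
    ∃ σ : Equiv.Perm N, P = (1 : Matrix N N ℂ).submatrix σ id := by
  obtain ⟨σ, hσ⟩ := hP
  refine ⟨σ, ?_⟩
  ext i j
  simp [hσ, Matrix.one_apply]

theorem idKronOnesRow_apply (n d : ℕ) (i : Fin n) (k : Fin n × Fin d) :
    idKronOnesRow n d i k = if i = k.1 then 1 else 0 := by
  simp [idKronOnesRow, Matrix.one_apply]

/-- Conjugating a diagonal matrix by a permutation matrix permutes its diagonal. -/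
theorem transpose_perm_mul_diagonal_mul_perm {N : Type*} [Fintype N] [DecidableEq N]
    (σ : Equiv.Perm N) (w : N → ℂ) :
    ((1 : Matrix N N ℂ).submatrix σ id)ᵀ * diagonal w * (1 : Matrix N N ℂ).submatrix σ id =
      diagonal (w ∘ σ.symm) := by
  ext i j
  rw [Matrix.mul_apply, ← Equiv.sum_comp σ.symm]
  simp only [Matrix.mul_diagonal, Matrix.transpose_apply, Matrix.submatrix_apply,
    Matrix.one_apply, Matrix.diagonal_apply, Equiv.apply_symm_apply, id_eq, Function.comp_apply]
  rw [Finset.sum_eq_single i]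
  · simp
  · intro k _ hk
    simp [hk]
  · simp

theorem idKronOnesRow_mul_perm_mul_diagonal_apply {n d : ℕ}
    (σ : Equiv.Perm (Fin n × Fin d)) (l : Fin n × Fin d → ℂ) (i : Fin n) (k : Fin n × Fin d) :
    (idKronOnesRow n d * (1 : Matrix (Fin n × Fin d) (Fin n × Fin d) ℂ).submatrix σ id *
      diagonal l) i k = if i = (σ.symm k).1 then l k else 0 := by
  rw [Matrix.mul_diagonal, Matrix.mul_apply, ← Equiv.sum_comp σ.symm]
  simp [idKronOnesRow_apply, Matrix.one_apply]

/-- Let `Λ` be diagonal, `P` a permutation matrix, `Φ` diagonal, and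
`Λ̲ := (I_n ⊗ 1_dᵀ)·P·Λ`. Then `Λ̲ᴴ Φ Λ̲ = Pᵀ (Φ ⊗ I_d) P · Λ̲ᴴ Λ̲`. -/
theorem underline_conj_diag_comm {n d : ℕ} (hn : 0 < n) (hd : 0 < d)
    (Λ P : Matrix (Fin n × Fin d) (Fin n × Fin d) ℂ)
    (Φ : Matrix (Fin n) (Fin n) ℂ)
    (hΛ : Λ.IsDiag) (hΦ : Φ.IsDiag) (hP : IsPermMatrix P) :
    (idKronOnesRow n d * P * Λ)ᴴ * Φ * (idKronOnesRow n d * P * Λ) =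
      Pᵀ * (Φ ⊗ₖ (1 : Matrix (Fin d) (Fin d) ℂ)) * P *
        ((idKronOnesRow n d * P * Λ)ᴴ * (idKronOnesRow n d * P * Λ)) := by
  obtain ⟨l, rfl⟩ : ∃ l, Λ = diagonal l := ⟨_, hΛ.diagonal_diag.symm⟩
  obtain ⟨φ, rfl⟩ : ∃ φ, Φ = diagonal φ := ⟨_, hΦ.diagonal_diag.symm⟩
  obtain ⟨σ, rfl⟩ := hP.exists_eq_submatrix
  have hK : diagonal φ ⊗ₖ (1 : Matrix (Fin d) (Fin d) ℂ) = diagonal (fun k => φ k.1) := by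
    rw [← Matrix.diagonal_one, Matrix.diagonal_kronecker_diagonal]
    simp
  rw [hK, transpose_perm_mul_diagonal_mul_perm,
    ← Matrix.mul_assoc (diagonal (_ ∘ _))]
  congr 1
  ext k i
  rw [Matrix.mul_diagonal, Matrix.diagonal_mul, Matrix.conjTranspose_apply,
    idKronOnesRow_mul_perm_mul_diagonal_apply]
  split_ifs with h
  · simp [h, mul_comm]
  · simp
end

section
/- Let n_r, n_c, d_r, d_c be positive integers, N_r = n_r·d_r, N_c = n_c·d_c, and d = d_r·d_c. Let S_r ∈ ℂ^{n_r×N_r} and S_c ∈ ℂ^{n_c×N_c} be the decimation matrices with factors d_r and d_c respectively, let S = S_r ⊗ S_c, and let F = F_{N_r} ⊗ F_{N_c} be the 2D unitary DFT matrix. Then F·Sᴴ S·Fᴴ = (1/d)·(J_{d_r} ⊗ I_{n_r}) ⊗ (J_{d_c} ⊗ I_{n_c}). -/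
open Matrix Kronecker

/-- The decimation matrix `S ∈ ℂ^{n × nd}` with factor `d`:
`S i j = 1` if `j = d·i` and `0` otherwise. -/
def decim (n d : ℕ) : Matrix (Fin n) (Fin (n * d)) ℂ :=
  Matrix.of fun i j => if (j : ℕ) = d * (i : ℕ) then 1 else 0

/-- The unitary DFT matrix of size `N`. -/
noncomputable def dftMatrix (N : ℕ) : Matrix (Fin N) (Fin N) ℂ :=
  Matrix.of fun j k => ((Real.sqrt N : ℝ) : ℂ)⁻¹ *
    Complex.exp ((-2 : ℂ) * (Real.pi : ℂ) * Complex.I * (j : ℕ) * (k : ℕ) / (N : ℂ))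

/-- The all-ones matrix `J_d`. -/
def onesMatrix (d : ℕ) : Matrix (Fin d) (Fin d) ℂ :=
  Matrix.of fun _ _ => (1 : ℂ)

/-- Orthogonality of the characters `i ↦ ζ ^ (a * i)` for a primitive `n`-th root of unity `ζ`. -/
theorem sum_pow_mul_star_pow_of_isPrimitiveRoot {n : ℕ} {ζ : ℂ} (hζ : IsPrimitiveRoot ζ n)
    (hn : 0 < n) (a b : Fin n) :
    ∑ i : Fin n, ζ ^ ((a : ℕ) * i) * star (ζ ^ ((b : ℕ) * i)) = if a = b then (n : ℂ) else 0 := by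
  have hζ0 : ζ ≠ 0 := hζ.ne_zero hn.ne'
  have hstar : star ζ = ζ⁻¹ := by
    rw [Complex.inv_eq_conj (Complex.norm_eq_one_of_pow_eq_one hζ.pow_eq_one hn.ne')]
    rfl
  have hterm (i : Fin n) : ζ ^ ((a : ℕ) * i) * star (ζ ^ ((b : ℕ) * i)) =
      (ζ ^ (a : ℕ) / ζ ^ (b : ℕ)) ^ (i : ℕ) := by
    rw [star_pow, hstar, div_pow, ← pow_mul, ← pow_mul, inv_pow, div_eq_mul_inv]
  simp only [hterm]
  rw [Fin.sum_univ_eq_sum_range (fun i => (ζ ^ (a : ℕ) / ζ ^ (b : ℕ)) ^ i)]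
  split_ifs with hab
  · simp [hab, div_self (pow_ne_zero _ hζ0)]
  · have hne : ζ ^ (a : ℕ) / ζ ^ (b : ℕ) ≠ 1 := fun h =>
      hab (Fin.ext (hζ.pow_inj a.2 b.2 ((div_eq_one_iff_eq (pow_ne_zero _ hζ0)).1 h)))
    rw [geom_sum_eq hne, div_pow, ← pow_mul, ← pow_mul, mul_comm (a : ℕ), mul_comm (b : ℕ),
      pow_mul, pow_mul, hζ.pow_eq_one]
    simp

/-- The columns of the DFT matrix selected by decimation are sampled characters of order `n`. -/
theorem dftMatrix_mul_conjTranspose_decim_apply {n d : ℕ} (hn : 0 < n) (hd : 0 < d)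
    (p : Fin d) (a i : Fin n) :
    (dftMatrix (n * d) * (decim n d)ᴴ)
        ((finProdFinEquiv.trans (finCongr (Nat.mul_comm d n))) (p, a)) i =
      ((Real.sqrt (n * d : ℕ) : ℝ) : ℂ)⁻¹ *
        (Complex.exp (2 * Real.pi * Complex.I / n))⁻¹ ^ ((a : ℕ) * i) := by
  have hlt : d * (i : ℕ) < n * d := by
    rw [mul_comm]; exact Nat.mul_lt_mul_of_pos_right i.2 hd
  rw [Matrix.mul_apply, Finset.sum_eq_single ⟨d * i, hlt⟩]
  · have hn' : (n : ℂ) ≠ 0 := by exact_mod_cast hn.ne'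
    have hd' : (d : ℂ) ≠ 0 := by exact_mod_cast hd.ne'
    simp only [dftMatrix, decim, Matrix.of_apply, Matrix.conjTranspose_apply, if_true, star_one,
      mul_one]
    congr 1
    rw [← Complex.exp_neg, ← Complex.exp_nat_mul, Complex.exp_eq_exp_iff_exists_int]
    refine ⟨-((p : ℤ) * i), ?_⟩
    simp
    field_simp
    ring
  · intro j _ hj
    have : (j : ℕ) ≠ d * i := fun h => hj (Fin.ext h)
    simp [decim, this]
  · simp

/-- One-dimensional form: conjugating the sampling projection by the DFT averages aliases. -/
theorem dft_decim_conj {n d : ℕ} (hn : 0 < n) (hd : 0 < d) :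
    dftMatrix (n * d) * ((decim n d)ᴴ * decim n d) * (dftMatrix (n * d))ᴴ =
      Matrix.reindex (finProdFinEquiv.trans (finCongr (Nat.mul_comm d n)))
        (finProdFinEquiv.trans (finCongr (Nat.mul_comm d n)))
        ((d : ℂ)⁻¹ • (onesMatrix d ⊗ₖ (1 : Matrix (Fin n) (Fin n) ℂ))) := by
  have hfac : dftMatrix (n * d) * ((decim n d)ᴴ * decim n d) * (dftMatrix (n * d))ᴴ =
      (dftMatrix (n * d) * (decim n d)ᴴ) * (dftMatrix (n * d) * (decim n d)ᴴ)ᴴ := by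
    simp only [Matrix.conjTranspose_mul, Matrix.conjTranspose_conjTranspose, Matrix.mul_assoc]
  have hζ := (Complex.isPrimitiveRoot_exp n hn.ne').inv
  have hn' : (n : ℂ) ≠ 0 := by exact_mod_cast hn.ne'
  have hd' : (d : ℂ) ≠ 0 := by exact_mod_cast hd.ne'
  have hsq : ((Real.sqrt (n * d : ℕ) : ℝ) : ℂ)⁻¹ * ((Real.sqrt (n * d : ℕ) : ℝ) : ℂ)⁻¹ =
      ((n : ℂ) * d)⁻¹ := by
    rw [← mul_inv, ← Complex.ofReal_mul, Real.mul_self_sqrt (Nat.cast_nonneg _)]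
    push_cast
    rfl
  rw [hfac]
  ext k l
  obtain ⟨⟨p, a⟩, rfl⟩ := (finProdFinEquiv.trans (finCongr (Nat.mul_comm d n))).surjective k
  obtain ⟨⟨q, b⟩, rfl⟩ := (finProdFinEquiv.trans (finCongr (Nat.mul_comm d n))).surjective l
  rw [Matrix.mul_apply, Matrix.reindex_apply, Matrix.submatrix_apply, Equiv.symm_apply_apply,
    Equiv.symm_apply_apply]
  simp only [Matrix.conjTranspose_apply, dftMatrix_mul_conjTranspose_decim_apply hn hd, star_mul']
  have hstar : star ((Real.sqrt (n * d : ℕ) : ℝ) : ℂ)⁻¹ =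
      ((Real.sqrt (n * d : ℕ) : ℝ) : ℂ)⁻¹ := by
    rw [star_inv₀]
    exact congrArg _ (Complex.conj_ofReal _)
  simp only [hstar]
  rw [Finset.sum_congr rfl fun _ _ => mul_mul_mul_comm _ _ _ _, ← Finset.mul_sum,
    sum_pow_mul_star_pow_of_isPrimitiveRoot hζ hn, hsq]
  by_cases hab : a = b
  · simp [hab, onesMatrix]
    field_simp
  · simp [hab, onesMatrix]

/-- `F·Sᴴ S·Fᴴ = (1/d)·(J_{d_r} ⊗ I_{n_r}) ⊗ (J_{d_c} ⊗ I_{n_c})`, where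
`S = S_r ⊗ S_c` is the 2D decimation matrix and `F = F_{N_r} ⊗ F_{N_c}` the 2D
unitary DFT matrix (with the natural identification of indices). -/
theorem dft_decim_conj_2d (nr nc dr dc : ℕ)
    (hnr : 0 < nr) (hnc : 0 < nc) (hdr : 0 < dr) (hdc : 0 < dc) :
    (dftMatrix (nr * dr) ⊗ₖ dftMatrix (nc * dc)) *
        ((decim nr dr ⊗ₖ decim nc dc)ᴴ * (decim nr dr ⊗ₖ decim nc dc)) *
        (dftMatrix (nr * dr) ⊗ₖ dftMatrix (nc * dc))ᴴ =
      Matrix.reindex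
        (Equiv.prodCongr (finProdFinEquiv.trans (finCongr (Nat.mul_comm dr nr)))
          (finProdFinEquiv.trans (finCongr (Nat.mul_comm dc nc))))
        (Equiv.prodCongr (finProdFinEquiv.trans (finCongr (Nat.mul_comm dr nr)))
          (finProdFinEquiv.trans (finCongr (Nat.mul_comm dc nc))))
        ((((dr : ℂ) * (dc : ℂ))⁻¹) •
          ((onesMatrix dr ⊗ₖ (1 : Matrix (Fin nr) (Fin nr) ℂ)) ⊗ₖ
            (onesMatrix dc ⊗ₖ (1 : Matrix (Fin nc) (Fin nc) ℂ)))) := by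
  rw [Matrix.conjTranspose_kronecker, Matrix.conjTranspose_kronecker, ← Matrix.mul_kronecker_mul,
    ← Matrix.mul_kronecker_mul, ← Matrix.mul_kronecker_mul, dft_decim_conj hnr hdr,
    dft_decim_conj hnc hdc]
  ext ⟨k, k'⟩ ⟨l, l'⟩
  simp only [Matrix.kroneckerMap_apply, Matrix.reindex_apply, Matrix.submatrix_apply,
    Matrix.smul_apply, smul_eq_mul, Equiv.prodCongr_symm, Equiv.prodCongr_apply, Prod.map, mul_inv]
  ring
end
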